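/- There is an infinite family of strings over the alphabet {0,1,2} such that for each string T of length n in the family, with appropriate prefix parameter ℓ = o(n), the number of phrases ẑ in the ReLZ parsing of T and the number of phrases z in the greedy LZ77 parsing of T satisfy ẑ = Ω(z · log n). -/

import Mathlib

/-- Start position (0-based) of the `j`-th phrase of a parsing. -/
def phraseStart {α : Type*} (P : List (List α)) (j : ℕ) : ℕ := ((P.take j).flatten).length

/-- An LZ-like parsing of `T`: a factorization into non-empty phrases where each
phrase is a single symbol or has an occurrence in `T` starting strictly before it. -/
def IsLZLike {α : Type*} (T : List α) (P : List (List α)) : Prop :=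
  T = P.flatten ∧ (∀ Q ∈ P, Q ≠ []) ∧
  ∀ j, j < P.length →
    (P.getD j []).length = 1 ∨
    ∃ p, p < phraseStart P j ∧ (T.drop p).take (P.getD j []).length = P.getD j []

/-- The greedy LZ77 parsing: an LZ-like parsing in which no phrase can be extended,
i.e., no strictly longer prefix of the remaining suffix has an earlier occurrence. -/
def IsGreedyLZ {α : Type*} (T : List α) (P : List (List α)) : Prop :=
  IsLZLike T P ∧
  ∀ j, j < P.length → ∀ L, (P.getD j []).length < L →
    phraseStart P j + L ≤ T.length →
    ¬ ∃ p, p < phraseStart P j ∧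
      (T.drop p).take L = (T.drop (phraseStart P j)).take L

/-- The Relative Lempel--Ziv parsing of `T` with reference `R`: each phrase is the
longest prefix of the remaining suffix occurring as a substring of `R`, or a literal. -/
def IsRLZ {α : Type*} (R T : List α) (P : List (List α)) : Prop :=
  T = P.flatten ∧ (∀ Q ∈ P, Q ≠ []) ∧
  (∀ j, j < P.length → (P.getD j []).length = 1 ∨ (P.getD j []) <:+: R) ∧
  ∀ j, j < P.length → ∀ L, (P.getD j []).length < L →
    phraseStart P j + L ≤ T.length →
    ¬ ((T.drop (phraseStart P j)).take L <:+: R)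

section Parsings

variable {α : Type*}

theorem phraseStart_succ {P : List (List α)} {j : ℕ} (hj : j < P.length) :
    phraseStart P (j + 1) = phraseStart P j + (P.getD j []).length := by
  rw [phraseStart, ← List.take_append_getElem hj, List.getD_eq_getElem _ _ hj,
    List.flatten_append, List.length_append, List.flatten_singleton, phraseStart]

theorem phraseStart_mono (P : List (List α)) : Monotone (phraseStart P) := by
  refine monotone_nat_of_le_succ fun j => ?_
  by_cases hj : j < P.length
  · rw [phraseStart_succ hj]; omega
  · simp only [phraseStart]
    rw [List.take_of_length_le (by omega), List.take_of_length_le (by omega)]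

theorem phraseStart_length (P : List (List α)) : phraseStart P P.length = P.flatten.length := by
  simp [phraseStart]

theorem getD_length_pos {P : List (List α)} (hP : ∀ Q ∈ P, Q ≠ []) {j : ℕ} (hj : j < P.length) :
    0 < (P.getD j []).length := by
  rw [List.getD_eq_getElem _ _ hj]
  exact List.length_pos_iff.2 (hP _ (List.getElem_mem hj))

theorem phraseStart_lt {P : List (List α)} (hP : ∀ Q ∈ P, Q ≠ []) {i j : ℕ} (hij : i < j)
    (hj : j ≤ P.length) : phraseStart P i < phraseStart P j := by
  have h1 := phraseStart_succ (P := P) (show i < P.length by omega)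
  have h2 := getD_length_pos hP (show i < P.length by omega)
  have h3 := phraseStart_mono P (show i + 1 ≤ j from hij)
  omega

theorem getD_eq_take_drop (P : List (List α)) {j : ℕ} (hj : j < P.length) :
    P.getD j [] = (P.flatten.drop (phraseStart P j)).take (P.getD j []).length := by
  have h : P.flatten = (P.take j).flatten ++ (P.getD j [] ++ (P.drop (j + 1)).flatten) := by
    conv_lhs => rw [← List.take_append_drop j P, List.flatten_append,
      List.drop_eq_getElem_cons hj, List.flatten_cons]
    rw [List.getD_eq_getElem _ _ hj]
  rw [h, phraseStart, List.drop_left, List.take_left]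

/-- The phrase containing a given position. -/
theorem exists_phrase_of_lt (P : List (List α)) {m : ℕ} (hm : m < P.flatten.length) :
    ∃ j < P.length, phraseStart P j ≤ m ∧ m < phraseStart P (j + 1) := by
  classical
  have hex : ∃ j, m < phraseStart P j := ⟨P.length, by rwa [phraseStart_length]⟩
  obtain ⟨j, hj⟩ : ∃ j, Nat.find hex = j + 1 := by
    refine Nat.exists_eq_succ_of_ne_zero fun h => ?_
    have := Nat.find_spec hex
    rw [h] at this
    simp [phraseStart] at this
  have h1 := Nat.find_spec hex
  have h2 := Nat.find_min hex (m := j) (by omega)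
  rw [hj] at h1
  refine ⟨j, ?_, by omega, h1⟩
  by_contra! hlen
  have := phraseStart_mono P hlen
  rw [phraseStart_length] at this
  omega

theorem getElem?_take_drop (T : List α) {p L x : ℕ} (hx : x < L) :
    ((T.drop p).take L)[x]? = T[p + x]? := by
  simp [hx]

theorem take_drop_ofFun_eq {n : ℕ} {t : ℕ → α} {p q L : ℕ} (hp : p + L ≤ n) (hq : q + L ≤ n)
    (h : ∀ x < L, t (p + x) = t (q + x)) :
    (((List.range n).map t).drop p).take L = (((List.range n).map t).drop q).take L := by
  refine List.ext_getElem? fun x => ?_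
  by_cases hx : x < L
  · rw [getElem?_take_drop _ hx, getElem?_take_drop _ hx]
    simp [show p + x < n by omega,
      show q + x < n by omega, h x hx]
  · simp [hx]

/-- If the positions are coloured so that any stretch with endpoints of equal colour has an
earlier occurrence, then a greedy parsing has at most as many phrases as there are colours. -/
theorem IsGreedyLZ.length_le_card {ι : Type*} {n : ℕ} {t : ℕ → α} {Z : List (List α)}
    (hZ : IsGreedyLZ ((List.range n).map t) Z) (g : ℕ → ι) (G : Finset ι)
    (hG : ∀ s < n, g s ∈ G)
    (hg : ∀ s s', s < s' → s' < n → g s = g s' →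
      ∃ p < s, ∀ x ≤ s' - s, t (p + x) = t (s + x)) :
    Z.length ≤ G.card := by
  obtain ⟨⟨hT, hne, -⟩, hmax⟩ := hZ
  have hn : phraseStart Z Z.length = n := by rw [phraseStart_length, ← hT]; simp
  have key : ∀ i j, i < j → j < Z.length → g (phraseStart Z i) ≠ g (phraseStart Z j) := by
    intro i j hij hj heq
    have h1 := phraseStart_lt hne hij hj.le
    have h2 := phraseStart_lt hne hj le_rfl
    have h3 := phraseStart_succ (P := Z) (show i < Z.length by omega)
    have h4 := phraseStart_mono Z (show i + 1 ≤ j from hij)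
    obtain ⟨p, hp, hpx⟩ := hg _ _ h1 (by omega) heq
    refine hmax i (by omega) (phraseStart Z j - phraseStart Z i + 1) (by omega)
      (by simp; omega) ⟨p, hp, ?_⟩
    exact take_drop_ofFun_eq (by omega) (by omega) fun x hx => hpx x (by omega)
  rw [← Finset.card_range Z.length]
  refine Finset.card_le_card_of_injOn (fun j => g (phraseStart Z j)) ?_ ?_
  · intro j hj
    have hj : j < Z.length := by simpa using hj
    exact hG _ (hn ▸ phraseStart_lt hne hj le_rfl)
  · intro i hi j hj heq
    have hi : i < Z.length := by simpa using hi
    have hj : j < Z.length := by simpa using hj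
    rcases lt_trichotomy i j with h | h | h
    · exact (key i j h hj heq).elim
    · exact h
    · exact (key j i h hi heq.symm).elim

/-- An LZ-like parsing has at least as many phrases as there are distinct pairs of
consecutive symbols. -/
theorem IsLZLike.card_le_length {Q : List α} {P : List (List α)} (hP : IsLZLike Q P)
    (D : Finset (α × α)) (hD : ∀ d ∈ D, ∃ m, Q[m]? = some d.1 ∧ Q[m + 1]? = some d.2) :
    D.card ≤ P.length := by
  classical
  obtain ⟨hQ, hne, hocc⟩ := hP
  have key : ∀ d ∈ D, ∃ m j, Q[m]? = some d.1 ∧ Q[m + 1]? = some d.2 ∧ j < P.length ∧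
      phraseStart P j = m + 1 := by
    intro d hd
    have hex := hD d hd
    obtain ⟨h1, h2⟩ := Nat.find_spec hex
    set m := Nat.find hex
    have hm : m + 1 < Q.length := (List.getElem?_eq_some_iff.1 h2).1
    obtain ⟨j, hj, hj1, hj2⟩ := exists_phrase_of_lt P (hQ ▸ hm)
    refine ⟨m, j, h1, h2, hj, ?_⟩
    by_contra hne'
    rw [phraseStart_succ hj] at hj2
    rcases hocc j hj with hl | ⟨p, hp, hpe⟩
    · omega
    · have hself := getD_eq_take_drop P hj
      rw [← hQ] at hself
      have hx : ∀ x < (P.getD j []).length, Q[p + x]? = Q[phraseStart P j + x]? := by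
        intro x hx
        rw [← getElem?_take_drop Q hx, hpe]
        conv_lhs => rw [hself]
        rw [getElem?_take_drop Q hx]
      refine Nat.find_min hex (m := p + (m - phraseStart P j)) (by omega) ⟨?_, ?_⟩
      · rw [hx _ (by omega), ← h1]; congr 1; omega
      · rw [add_assoc, hx _ (by omega), ← h2]; congr 1; omega
  choose! m j h1 h2 hj hs using key
  rw [← Finset.card_range P.length]
  refine Finset.card_le_card_of_injOn j (fun d hd => by simpa using hj d hd) ?_
  intro d hd e he hde
  have hm : m d = m e := by
    have := hs d hd
    have := hs e he
    rw [hde] at *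
    omega
  have ha := h1 d hd
  have hb := h2 d hd
  rw [hm] at ha hb
  exact Prod.ext (Option.some.inj (ha.symm.trans (h1 e he)))
    (Option.some.inj (hb.symm.trans (h2 e he)))

/-- If every stretch of length `b` of `T` occurs in `R` and no longer stretch does, then the
relative parsing of `T` cuts it into blocks of length `b`. -/
theorem IsRLZ.getElem?_eq_block {R T : List α} {P : List (List α)} (hP : IsRLZ R T P) {b N : ℕ}
    (hb : 0 < b) (hT : T.length = b * N)
    (hin : ∀ q, q + b ≤ T.length → (T.drop q).take b <:+: R)
    (hout : ∀ q L, b < L → q + L ≤ T.length → ¬ (T.drop q).take L <:+: R) {j : ℕ} (hj : j < N) :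
    P[j]? = some ((T.drop (b * j)).take b) := by
  obtain ⟨hf, hne, hocc, hmax⟩ := hP
  have hlen : ∀ j < N, phraseStart P j = b * j →
      j < P.length ∧ (P.getD j []).length = b := by
    intro j hj hs
    have hjb : b * j + b ≤ b * N := by
      calc b * j + b = b * (j + 1) := by ring
        _ ≤ b * N := Nat.mul_le_mul_left _ hj
    have hjl : j < P.length := by
      by_contra! h
      have := phraseStart_mono P h
      rw [phraseStart_length, ← hf] at this
      omega
    refine ⟨hjl, le_antisymm ?_ ?_⟩
    · by_contra! h
      have hfit : phraseStart P j + (P.getD j []).length ≤ T.length := by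
        rw [← phraseStart_succ hjl, hf, ← phraseStart_length]
        exact phraseStart_mono P hjl
      rcases hocc j hjl with h1 | h1
      · omega
      · rw [getD_eq_take_drop P hjl, ← hf] at h1
        exact hout _ _ h hfit h1
    · by_contra! h
      exact hmax j hjl b h (by omega) (hin _ (by omega))
  have hstart : ∀ j ≤ N, phraseStart P j = b * j := by
    intro j
    induction j with
    | zero => intro; simp [phraseStart]
    | succ j ih =>
      intro h
      obtain ⟨h1, h2⟩ := hlen j h (ih (by omega))
      rw [phraseStart_succ h1, ih (by omega), h2]; ring
  obtain ⟨h1, h2⟩ := hlen j hj (hstart j hj.le)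
  have h3 := getD_eq_take_drop P h1
  rw [h2, ← hf, hstart j hj.le] at h3
  rw [← h3, List.getD_eq_getElem _ _ h1, List.getElem?_eq_getElem h1]

end Parsings

/-- The `k`-th binary digit of `v`, least significant first, as a symbol. -/
def digitSymbol (v k : ℕ) : Fin 3 := if v.testBit k then 1 else 0

/-- The concatenation of the `b`-digit binary expansions of `0, 1, 2, …`. -/
def counterSymbol (b j : ℕ) : Fin 3 := digitSymbol (j / b) (j % b)

/-- The concatenation of all `b`-digit expansions, each followed by the separator `2`, and then
for each `i < b` the first `b * 2 ^ b` symbols of the counter sequence shifted by `i`. -/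
def familySymbol (b x : ℕ) : Fin 3 :=
  if x < (b + 1) * 2 ^ b then
    if x % (b + 1) = b then 2 else digitSymbol (x / (b + 1)) (x % (b + 1))
  else counterSymbol b
    ((x - (b + 1) * 2 ^ b) / (b * 2 ^ b) + (x - (b + 1) * 2 ^ b) % (b * 2 ^ b))

/-- The length of the family member with parameter `b`. -/
def familyLength (b : ℕ) : ℕ := (b + 1) * 2 ^ b + b * (b * 2 ^ b)

theorem digitSymbol_ne_two (v k : ℕ) : digitSymbol v k ≠ 2 := by
  unfold digitSymbol; split <;> decide

theorem digitSymbol_eq_iff {v k w l : ℕ} :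
    digitSymbol v k = digitSymbol w l ↔ v.testBit k = w.testBit l := by
  unfold digitSymbol
  cases v.testBit k <;> cases w.testBit l <;> simp

theorem counterSymbol_block {b k : ℕ} (v : ℕ) (hk : k < b) :
    counterSymbol b (b * v + k) = digitSymbol v k := by
  unfold counterSymbol
  rw [Nat.mul_add_div (by omega), Nat.mul_add_mod, Nat.div_eq_of_lt hk, Nat.mod_eq_of_lt hk,
    add_zero]

theorem reference_position_lt {b v k : ℕ} (hv : v < 2 ^ b) (hk : k ≤ b) :
    (b + 1) * v + k < (b + 1) * 2 ^ b := by
  have := Nat.mul_le_mul_left (b + 1) (show v + 1 ≤ 2 ^ b from hv)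
  rw [mul_add] at this
  omega

theorem familySymbol_reference {b v k : ℕ} (hv : v < 2 ^ b) (hk : k < b) :
    familySymbol b ((b + 1) * v + k) = digitSymbol v k := by
  unfold familySymbol
  rw [if_pos (reference_position_lt hv hk.le), Nat.mul_add_div (by omega), Nat.mul_add_mod,
    Nat.div_eq_of_lt (by omega), Nat.mod_eq_of_lt (by omega), if_neg (by omega), add_zero]

theorem familySymbol_separator {b v : ℕ} (hv : v < 2 ^ b) :
    familySymbol b ((b + 1) * v + b) = 2 := by
  unfold familySymbol
  rw [if_pos (reference_position_lt hv le_rfl), Nat.mul_add_mod, Nat.mod_eq_of_lt (by omega),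
    if_pos rfl]

theorem familySymbol_shift {b i r : ℕ} (hr : r < b * 2 ^ b) :
    familySymbol b ((b + 1) * 2 ^ b + (b * 2 ^ b * i + r)) = counterSymbol b (i + r) := by
  unfold familySymbol
  rw [if_neg (by omega), Nat.add_sub_cancel_left, Nat.mul_add_div (by omega), Nat.mul_add_mod,
    Nat.div_eq_of_lt hr, Nat.mod_eq_of_lt hr, add_zero]

theorem exists_lt_two_pow_digitSymbol_eq (b : ℕ) (f : ℕ → Fin 3) (hf : ∀ k < b, f k ≠ 2) :
    ∃ v < 2 ^ b, ∀ k < b, digitSymbol v k = f k := by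
  refine ⟨Nat.ofBits (fun k : Fin b => decide (f k = 1)), Nat.ofBits_lt_two_pow _, ?_⟩
  intro k hk
  unfold digitSymbol
  rw [Nat.testBit_ofBits_lt _ _ hk]
  have := hf k hk
  generalize f k = c at *
  revert this
  revert c
  decide

/-- Windows of two blocks of the counter sequence that start inside an even number are
distinct. -/
theorem counterSymbol_window_injective {b i i' u u' : ℕ} (hi : 1 ≤ i) (hib : i < b)
    (hi' : 1 ≤ i') (hib' : i' < b) (hu : 2 * u + 1 < 2 ^ b) (hu' : 2 * u' + 1 < 2 ^ b)
    (h : ∀ x < 2 * b,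
      counterSymbol b (i + b * (2 * u) + x) = counterSymbol b (i' + b * (2 * u') + x)) :
    i = i' ∧ u = u' := by
  have high : ∀ w k, 1 ≤ k → (2 * w).testBit k = (2 * w + 1).testBit k := by
    intro w k hk
    obtain ⟨k, rfl⟩ := Nat.exists_eq_succ_of_ne_zero (show k ≠ 0 by omega)
    rw [Nat.testBit_succ, Nat.testBit_succ]
    congr 1; omega
  have first : ∀ {i w x : ℕ}, i + x < b →
      counterSymbol b (i + b * w + x) = digitSymbol w (i + x) := by
    intro i w x hx
    rw [← counterSymbol_block w hx]; congr 1; ring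
  have second : ∀ {i w x k : ℕ}, i + x = b + k → k < b →
      counterSymbol b (i + b * w + x) = digitSymbol (w + 1) k := by
    intro i w x k hx hk
    rw [← counterSymbol_block (w + 1) hk]; congr 1; rw [mul_add]; omega
  have third : ∀ {i w x k : ℕ}, i + x = 2 * b + k → k < b →
      counterSymbol b (i + b * w + x) = digitSymbol (w + 2) k := by
    intro i w x k hx hk
    rw [← counterSymbol_block (w + 2) hk]; congr 1; rw [mul_add]; omega
  have le : ∀ {i i' u u' : ℕ}, 1 ≤ i → i < b → 1 ≤ i' → i' < b → (∀ x < 2 * b,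
      counterSymbol b (i + b * (2 * u) + x) = counterSymbol b (i' + b * (2 * u') + x)) →
      i' ≤ i := by
    intro i i' u u' hi hib hi' hib' h
    by_contra! hlt
    have h1 := h (b - i') (by omega)
    have h2 := h (2 * b - i') (by omega)
    rw [first (by omega), second (k := 0) (by omega) (by omega), digitSymbol_eq_iff] at h1
    rw [second (k := i + (b - i')) (by omega) (by omega),
      third (k := 0) (by omega) (by omega), digitSymbol_eq_iff] at h2
    rw [high _ _ (by omega), h2, Nat.testBit_zero, Nat.testBit_zero] at h1
    simp only [decide_eq_decide] at h1
    omega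
  obtain rfl : i = i' :=
    le_antisymm (le hi' hib' hi hib fun x hx => (h x hx).symm) (le hi hib hi' hib' h)
  refine ⟨rfl, ?_⟩
  have : 2 * u + 1 = 2 * u' + 1 := by
    refine Nat.eq_of_testBit_eq fun k => ?_
    by_cases hkb : k < b
    · by_cases hki : k < i
      · have h1 := h (b - i + k) (by omega)
        rwa [second (k := k) (by omega) hkb, second (k := k) (by omega) hkb,
          digitSymbol_eq_iff] at h1
      · have h1 := h (k - i) (by omega)
        rw [first (by omega), first (by omega), digitSymbol_eq_iff] at h1
        rw [← high _ _ (by omega), ← high _ _ (by omega)]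
        convert h1 using 2 <;> omega
    · have hpow : 2 ^ b ≤ 2 ^ k := Nat.pow_le_pow_right (by omega) (by omega)
      rw [Nat.testBit_lt_two_pow (by omega), Nat.testBit_lt_two_pow (by omega)]
  omega

/-- A colouring of the positions of a family member for which every stretch with endpoints of
equal colour has an earlier occurrence. -/
def familyColour (b x : ℕ) : ℕ × ℕ :=
  if x < (b + 1) * 2 ^ b then
    if x / (b + 1) = 0 then (0, x % (b + 1))
    else if x % (b + 1) < Nat.log 2 (x / (b + 1)) then (1, x / (b + 1))
    else if x % (b + 1) = Nat.log 2 (x / (b + 1)) then (2, x / (b + 1))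
    else (3, x / (b + 1))
  else if (x - (b + 1) * 2 ^ b) / (b * 2 ^ b) = 0 then
    (4, (x - (b + 1) * 2 ^ b) % (b * 2 ^ b) / b)
  else if (x - (b + 1) * 2 ^ b) % (b * 2 ^ b) < b * (2 ^ b - 1) then
    (5, (x - (b + 1) * 2 ^ b) / (b * 2 ^ b))
  else (6, (x - (b + 1) * 2 ^ b) / (b * 2 ^ b))

theorem familyColour_reference {b v k : ℕ} (hv : v < 2 ^ b) (hk : k ≤ b) :
    familyColour b ((b + 1) * v + k) =
      if v = 0 then (0, k) else if k < Nat.log 2 v then (1, v)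
      else if k = Nat.log 2 v then (2, v) else (3, v) := by
  unfold familyColour
  rw [if_pos (reference_position_lt hv hk), Nat.mul_add_div (by omega), Nat.mul_add_mod,
    Nat.div_eq_of_lt (by omega), Nat.mod_eq_of_lt (by omega), add_zero]

theorem familyColour_shift {b i r : ℕ} (hr : r < b * 2 ^ b) :
    familyColour b ((b + 1) * 2 ^ b + (b * 2 ^ b * i + r)) =
      if i = 0 then (4, r / b) else if r < b * (2 ^ b - 1) then (5, i) else (6, i) := by
  unfold familyColour
  rw [if_neg (by omega), Nat.add_sub_cancel_left, Nat.mul_add_div (by omega), Nat.mul_add_mod,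
    Nat.div_eq_of_lt hr, Nat.mod_eq_of_lt hr, add_zero]

theorem family_position_cases {b x : ℕ} (hx : x < familyLength b) :
    (∃ v < 2 ^ b, ∃ k ≤ b, x = (b + 1) * v + k) ∨
      ∃ i < b, ∃ r < b * 2 ^ b, x = (b + 1) * 2 ^ b + (b * 2 ^ b * i + r) := by
  unfold familyLength at hx
  by_cases h : x < (b + 1) * 2 ^ b
  · exact .inl ⟨x / (b + 1), Nat.div_lt_of_lt_mul h, x % (b + 1),
      Nat.lt_succ_iff.1 (Nat.mod_lt _ (by omega)), (Nat.div_add_mod _ _).symm⟩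
  · have hpos : 0 < b * 2 ^ b := by
      by_contra! h0
      rw [Nat.le_zero.1 h0] at hx
      omega
    refine .inr ⟨(x - (b + 1) * 2 ^ b) / (b * 2 ^ b), ?_,
      (x - (b + 1) * 2 ^ b) % (b * 2 ^ b), Nat.mod_lt _ hpos, ?_⟩
    · rw [Nat.div_lt_iff_lt_mul hpos]; omega
    · rw [Nat.div_add_mod]; omega

theorem familyColour_mem {b x : ℕ} (hx : x < familyLength b) :
    familyColour b x ∈ Finset.range 7 ×ˢ Finset.range (2 ^ b) := by
  have hb : b < 2 ^ b := Nat.lt_two_pow_self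
  rcases family_position_cases hx with ⟨v, hv, k, hk, rfl⟩ | ⟨i, hi, r, hr, rfl⟩
  · rw [familyColour_reference hv hk]
    split_ifs <;> simp <;> omega
  · rw [familyColour_shift hr]
    have : r / b < 2 ^ b := Nat.div_lt_of_lt_mul hr
    split_ifs <;> simp <;> omega

theorem counterSymbol_ne_two (b j : ℕ) : counterSymbol b j ≠ 2 := digitSymbol_ne_two _ _

theorem exists_earlier_of_familyColour_reference {b v k k' : ℕ} (hv : v < 2 ^ b) (hk' : k' ≤ b)
    (hkk : k < k')
    (h : familyColour b ((b + 1) * v + k) = familyColour b ((b + 1) * v + k')) :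
    ∃ p < (b + 1) * v + k, ∀ x ≤ k' - k,
      familySymbol b (p + x) = familySymbol b ((b + 1) * v + k + x) := by
  rw [familyColour_reference hv (by omega), familyColour_reference hv hk'] at h
  have hv0 : v ≠ 0 := by
    rintro rfl
    simp at h
    omega
  have hlow := Nat.pow_log_le_self 2 hv0
  have hhigh := Nat.lt_pow_succ_log_self (b := 2) (by omega) v
  have hlog : Nat.log 2 v < b := (Nat.pow_lt_pow_iff_right (by omega)).1 (hlow.trans_lt hv)
  have hsplit : k' < Nat.log 2 v ∨ Nat.log 2 v < k := by
    rw [if_neg hv0, if_neg hv0] at h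
    split_ifs at h <;> simp at h <;> omega
  rcases hsplit with hlt | hgt
  · have hmod := Nat.mod_lt v (show 0 < 2 ^ Nat.log 2 v by positivity)
    have hmul := Nat.mul_lt_mul_of_pos_left (hmod.trans_le hlow) (show 0 < b + 1 by omega)
    refine ⟨(b + 1) * (v % 2 ^ Nat.log 2 v) + k, by omega, fun x hx => ?_⟩
    rw [add_assoc, add_assoc, familySymbol_reference (by omega) (by omega),
      familySymbol_reference hv (by omega), digitSymbol_eq_iff, Nat.testBit_mod_two_pow]
    simp [show k + x < Nat.log 2 v by omega]
  · have hmul := Nat.mul_lt_mul_of_pos_left (Nat.pos_of_ne_zero hv0) (show 0 < b + 1 by omega)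
    refine ⟨(b + 1) * 0 + k, by omega, fun x hx => ?_⟩
    rw [add_assoc, add_assoc]
    rcases (show k + x ≤ b by omega).lt_or_eq with hb | hb
    · rw [familySymbol_reference (by omega) hb, familySymbol_reference hv hb,
        digitSymbol_eq_iff, Nat.zero_testBit, Nat.testBit_lt_two_pow]
      exact hhigh.trans_le (Nat.pow_le_pow_right (by omega) (by omega))
    · rw [hb, familySymbol_separator (by omega), familySymbol_separator hv]

theorem exists_earlier_of_familyColour_shift {b i r r' : ℕ} (hi : i < b) (hrr : r < r')
    (hr' : r' < b * 2 ^ b)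
    (h : i = 0 → r / b = r' / b) (h' : i ≠ 0 → (r < b * (2 ^ b - 1) ↔ r' < b * (2 ^ b - 1))) :
    ∃ p < (b + 1) * 2 ^ b + (b * 2 ^ b * i + r), ∀ x ≤ r' - r, familySymbol b (p + x) =
      familySymbol b ((b + 1) * 2 ^ b + (b * 2 ^ b * i + r) + x) := by
  have hpow : b < 2 ^ b := Nat.lt_two_pow_self
  have hlast : b * (2 ^ b - 1) + b = b * 2 ^ b := by
    rw [← Nat.mul_succ]; congr 1; omega
  have hshift : ∀ x ≤ r' - r, familySymbol b ((b + 1) * 2 ^ b + (b * 2 ^ b * i + r) + x) =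
      counterSymbol b (i + r + x) := by
    intro x hx
    rw [add_assoc, add_assoc, familySymbol_shift (by omega), add_assoc]
  by_cases hin : i ≠ 0 ∧ r' < b * (2 ^ b - 1)
  · obtain ⟨hi0, hr1⟩ := hin
    have hmul : 2 * i ≤ b * 2 ^ b * i := by
      refine Nat.mul_le_mul_right _ ?_
      nlinarith
    refine ⟨(b + 1) * 2 ^ b + (b * 2 ^ b * 0 + (i + r)), by omega, fun x hx => ?_⟩
    rw [hshift x hx, add_assoc, add_assoc, familySymbol_shift (by omega), zero_add]
  · have hfit : r' - r < b := by
      by_cases hi0 : i = 0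
      · have := h hi0
        have h1 := Nat.div_add_mod r b
        have h2 := Nat.div_add_mod r' b
        have h3 := Nat.mod_lt r' (show 0 < b by omega)
        rw [this] at h1
        omega
      · have := h' hi0
        omega
    obtain ⟨v, hv, hvk⟩ := exists_lt_two_pow_digitSymbol_eq b
      (fun k => counterSymbol b (i + r + k)) fun k _ => counterSymbol_ne_two _ _
    have := reference_position_lt hv (Nat.zero_le b)
    refine ⟨(b + 1) * v + 0, by omega, fun x hx => ?_⟩
    rw [hshift x hx, add_zero, familySymbol_reference hv (by omega), hvk x (by omega)]

theorem exists_earlier_of_familyColour_eq {b s s' : ℕ} (hs : s < s') (hs' : s' < familyLength b)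
    (h : familyColour b s = familyColour b s') :
    ∃ p < s, ∀ x ≤ s' - s, familySymbol b (p + x) = familySymbol b (s + x) := by
  rcases family_position_cases (hs.trans hs') with ⟨v, hv, k, hk, rfl⟩ | ⟨i, hi, r, hr, rfl⟩ <;>
    rcases family_position_cases hs' with ⟨v', hv', k', hk', rfl⟩ | ⟨i', hi', r', hr', rfl⟩
  · obtain rfl : v = v' := by
      rw [familyColour_reference hv hk, familyColour_reference hv' hk'] at h
      split_ifs at h <;> simp at h <;> omega
    rw [Nat.add_sub_add_left]
    exact exists_earlier_of_familyColour_reference hv hk' (by omega) h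
  · rw [familyColour_reference hv hk, familyColour_shift hr'] at h
    split_ifs at h <;> simp at h
  · rw [familyColour_shift hr, familyColour_reference hv' hk'] at h
    split_ifs at h <;> simp at h
  · rw [familyColour_shift hr, familyColour_shift hr'] at h
    obtain rfl : i = i' := by split_ifs at h <;> simp at h <;> omega
    rw [Nat.add_sub_add_left, Nat.add_sub_add_left]
    refine exists_earlier_of_familyColour_shift hi (by omega) hr' ?_ ?_
    · intro hi0
      simpa [hi0] using h
    · intro hi0
      rw [if_neg hi0, if_neg hi0] at h
      split_ifs at h <;> simp at h <;> omega

/-- The member of the family with parameter `b`. -/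
def familyString (b : ℕ) : List (Fin 3) := (List.range (familyLength b)).map (familySymbol b)

theorem IsGreedyLZ.length_le_of_familyString {b : ℕ} {Z : List (List (Fin 3))}
    (hZ : IsGreedyLZ (familyString b) Z) : Z.length ≤ 7 * 2 ^ b := by
  simpa using hZ.length_le_card (familyColour b) (Finset.range 7 ×ˢ Finset.range (2 ^ b))
    (fun _ hs => familyColour_mem hs)
    (fun _ _ hs hs' h => exists_earlier_of_familyColour_eq hs hs' h)

theorem length_familyString (b : ℕ) : (familyString b).length = familyLength b := by
  simp [familyString]

theorem getElem?_familyString {b x : ℕ} (hx : x < familyLength b) :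
    (familyString b)[x]? = some (familySymbol b x) := by
  simp [familyString, hx]

theorem familySymbol_ne_two {b x : ℕ} (hx : (b + 1) * 2 ^ b ≤ x) : familySymbol b x ≠ 2 := by
  rw [familySymbol, if_neg (by omega)]
  exact counterSymbol_ne_two _ _

theorem familyString_window_infix {b q : ℕ} (hq : (b + 1) * 2 ^ b ≤ q)
    (hqb : q + b ≤ familyLength b) :
    ((familyString b).drop q).take b <:+: (familyString b).take ((b + 1) * 2 ^ b) := by
  obtain ⟨v, hv, hvk⟩ := exists_lt_two_pow_digitSymbol_eq b
    (fun k => familySymbol b (q + k)) fun k _ => familySymbol_ne_two (by omega)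
  have hpos := reference_position_lt hv le_rfl
  have heq : ((familyString b).drop q).take b =
      (((familyString b).take ((b + 1) * 2 ^ b)).drop ((b + 1) * v)).take b := by
    rw [List.drop_take, List.take_take, min_eq_left (by omega)]
    refine take_drop_ofFun_eq hqb (by unfold familyLength; omega) fun x hx => ?_
    rw [familySymbol_reference hv hx, hvk x hx]
  rw [heq]
  exact (List.take_prefix _ _).isInfix.trans (List.drop_suffix _ _).isInfix

theorem familyString_window_not_infix {b q L : ℕ} (hq : (b + 1) * 2 ^ b ≤ q) (hL : b < L)
    (hqL : q + L ≤ familyLength b) :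
    ¬ ((familyString b).drop q).take L <:+: (familyString b).take ((b + 1) * 2 ^ b) := by
  rintro ⟨u, w, huw⟩
  have hlen := congrArg List.length huw
  simp only [List.length_append, List.length_take, List.length_drop, length_familyString] at hlen
  have hfam : familyLength b = (b + 1) * 2 ^ b + b * (b * 2 ^ b) := rfl
  have hmod := Nat.mod_lt u.length (show 0 < b + 1 by omega)
  have hdiv := Nat.div_add_mod u.length (b + 1)
  obtain ⟨x, hx⟩ : ∃ x, x + u.length % (b + 1) = b := ⟨b - u.length % (b + 1), by omega⟩
  have hpos : u.length + x = (b + 1) * (u.length / (b + 1)) + b := by omega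
  have hv : u.length / (b + 1) < 2 ^ b := Nat.div_lt_of_lt_mul (by omega)
  have h := congrArg (·[u.length + x]?) huw
  rw [List.getElem?_append_left (by simp [length_familyString]; omega),
    List.getElem?_append_right (by omega), Nat.add_sub_cancel_left,
    getElem?_take_drop _ (by omega), getElem?_familyString (by omega),
    List.getElem?_take_of_lt (by omega), getElem?_familyString (by omega), hpos,
    familySymbol_separator hv] at h
  exact familySymbol_ne_two (by omega) (Option.some.inj h)

theorem getElem?_drop_familyString {b i r : ℕ} (hi : i < b) (hr : r < b * 2 ^ b) :
    ((familyString b).drop ((b + 1) * 2 ^ b))[b * 2 ^ b * i + r]? =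
      some (counterSymbol b (i + r)) := by
  have := Nat.mul_le_mul_left (b * 2 ^ b) (show i + 1 ≤ b from hi)
  rw [mul_add, mul_comm _ b] at this
  rw [List.getElem?_drop, getElem?_familyString (by unfold familyLength; omega),
    familySymbol_shift hr]

theorem length_ge_of_familyString {b : ℕ} {P₁ P₂ : List (List (Fin 3))}
    {P' : List (List (List (Fin 3)))}
    (h₂ : IsRLZ ((familyString b).take ((b + 1) * 2 ^ b))
      ((familyString b).drop ((b + 1) * 2 ^ b)) P₂)
    (h' : IsLZLike (P₁ ++ P₂) P') :
    (b - 1) * 2 ^ (b - 1) ≤ P'.length := by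
  rcases Nat.eq_zero_or_pos b with rfl | hb
  · simp
  set T' := (familyString b).drop ((b + 1) * 2 ^ b) with hT'
  have hlen : T'.length = b * (b * 2 ^ b) := by
    simp [hT', length_familyString, familyLength]
  have hfam : familyLength b = (b + 1) * 2 ^ b + b * (b * 2 ^ b) := rfl
  have hpow : 2 ^ b = 2 * 2 ^ (b - 1) := by rw [← pow_succ']; congr 1; omega
  have hblock : ∀ j < b * 2 ^ b, P₂[j]? = some ((T'.drop (b * j)).take b) := by
    intro j hj
    refine h₂.getElem?_eq_block hb hlen ?_ ?_ hj
    · intro q hq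
      rw [hT', List.drop_drop]
      exact familyString_window_infix (by omega) (by omega)
    · intro q L hL hq
      rw [hT', List.drop_drop]
      exact familyString_window_not_infix (by omega) hL (by omega)
  let pair : ℕ × ℕ → List (Fin 3) × List (Fin 3) := fun c =>
    ((T'.drop (b * (2 ^ b * c.1 + 2 * c.2))).take b,
      (T'.drop (b * (2 ^ b * c.1 + 2 * c.2 + 1))).take b)
  let I := Finset.Ico 1 b ×ˢ Finset.range (2 ^ (b - 1))
  have hI : ∀ c ∈ I, 1 ≤ c.1 ∧ c.1 < b ∧ 2 * c.2 + 1 < 2 ^ b := by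
    intro c hc
    simp only [I, Finset.mem_product, Finset.mem_Ico, Finset.mem_range] at hc
    omega
  have hwindow : ∀ c ∈ I, ∀ x < 2 * b,
      (if x < b then (pair c).1[x]? else (pair c).2[x - b]?) =
        some (counterSymbol b (c.1 + b * (2 * c.2) + x)) := by
    intro c hc x hx
    obtain ⟨h1, h2, h3⟩ := hI c hc
    have hr := Nat.mul_le_mul_left b (show 2 * c.2 + 2 ≤ 2 ^ b from h3)
    rw [mul_add] at hr
    have hget := getElem?_drop_familyString h2 (r := b * (2 * c.2) + x) (by omega)
    rw [← add_assoc c.1] at hget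
    rw [← hget]
    split_ifs with hxb
    · rw [getElem?_take_drop _ hxb]
      congr 1; ring
    · rw [getElem?_take_drop _ (by omega)]
      congr 1
      obtain ⟨y, rfl⟩ := Nat.exists_eq_add_of_le (not_lt.1 hxb)
      rw [Nat.add_sub_cancel_left]
      ring
  have hinj : Set.InjOn pair I := by
    intro c hc d hd hcd
    obtain ⟨h1, h2, h3⟩ := hI c hc
    obtain ⟨h1', h2', h3'⟩ := hI d hd
    obtain ⟨e1, e2⟩ := counterSymbol_window_injective h1 h2 h1' h2' h3 h3' fun x hx => by
      have ha := hwindow c hc x hx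
      rw [hcd, hwindow d hd x hx] at ha
      exact (Option.some.inj ha).symm
    exact Prod.ext e1 e2
  have hcard := h'.card_le_length (I.image pair) ?_
  · rw [Finset.card_image_of_injOn hinj] at hcard
    simpa [I] using hcard
  · intro d hd
    obtain ⟨c, hc, rfl⟩ := Finset.mem_image.1 hd
    obtain ⟨h1, h2, h3⟩ := hI c hc
    have hmul := Nat.mul_le_mul_left (2 ^ b) (show c.1 + 1 ≤ b from h2)
    rw [mul_add, mul_comm _ b] at hmul
    refine ⟨P₁.length + (2 ^ b * c.1 + 2 * c.2), ?_, ?_⟩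
    · rw [List.getElem?_append_right (by omega), Nat.add_sub_cancel_left, hblock _ (by omega)]
    · rw [add_assoc, List.getElem?_append_right (by omega), Nat.add_sub_cancel_left,
        hblock _ (by omega)]

theorem familyLength_lt_succ (b : ℕ) : familyLength b < familyLength (b + 1) := by
  have h1 : 0 < 2 ^ b := by positivity
  unfold familyLength
  rw [pow_succ]
  nlinarith [Nat.zero_le (b * 2 ^ b), Nat.zero_le (b * (b * 2 ^ b))]

theorem logb_familyLength_le {b : ℕ} (hb : 1 ≤ b) :
    Real.logb 2 (familyLength b) ≤ 3 * b := by
  have hle : familyLength b ≤ 2 ^ (3 * b) := by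
    have hquad : b + 1 + b * b ≤ 4 ^ b := by
      induction b, hb using Nat.le_induction with
      | base => norm_num
      | succ n hn ih => rw [pow_succ]; nlinarith
    calc familyLength b = (b + 1 + b * b) * 2 ^ b := by unfold familyLength; ring
      _ ≤ 4 ^ b * 2 ^ b := Nat.mul_le_mul_right _ hquad
      _ = 2 ^ (3 * b) := by rw [← mul_pow, pow_mul]; norm_num
  have hpos : 0 < familyLength b := by unfold familyLength; positivity
  rw [Real.logb_le_iff_le_rpow (by norm_num) (by exact_mod_cast hpos)]
  calc (familyLength b : ℝ) ≤ 2 ^ (3 * b) := by exact_mod_cast hle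
    _ = (2 : ℝ) ^ (3 * b : ℝ) := by rw [← Real.rpow_natCast]; push_cast; rfl

theorem relz_lower_bound :
    ∃ (T : ℕ → List (Fin 3)) (ℓ : ℕ → ℕ) (C : ℝ), 0 < C ∧
      (∀ k, (T k).length < (T (k + 1)).length) ∧
      (∀ ε : ℝ, 0 < ε → ∃ K, ∀ k ≥ K, (ℓ k : ℝ) ≤ ε * (T k).length) ∧
      ∀ k, ℓ k ≤ (T k).length ∧
        ∀ (P1 P2 : List (List (Fin 3))) (P' : List (List (List (Fin 3))))
          (Z : List (List (Fin 3))),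
          IsGreedyLZ ((T k).take (ℓ k)) P1 →
          IsRLZ ((T k).take (ℓ k)) ((T k).drop (ℓ k)) P2 →
          IsGreedyLZ (P1 ++ P2) P' →
          IsGreedyLZ (T k) Z →
          C * Z.length * Real.logb 2 ((T k).length) ≤ (P'.length : ℝ) := by
  refine ⟨fun k => familyString (k + 2), fun k => (k + 2 + 1) * 2 ^ (k + 2), 1 / 84,
    by norm_num, ?_, ?_, ?_⟩
  · intro k
    simpa only [length_familyString] using familyLength_lt_succ (k + 2)
  · intro ε hε
    obtain ⟨K, hK⟩ := exists_nat_ge (1 / ε)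
    refine ⟨K, fun k hk => ?_⟩
    have hεk : 1 ≤ ε * (k + 2) := by
      have : (K : ℝ) ≤ k := by exact_mod_cast hk
      rw [div_le_iff₀' hε] at hK
      nlinarith
    simp only [length_familyString, familyLength]
    push_cast
    have hpow : (0 : ℝ) < 2 ^ (k + 2) := by positivity
    have hk0 : (0 : ℝ) ≤ k := k.cast_nonneg
    have hmain : (k + 2 + 1 : ℝ) ≤ ε * (k + 2 + 1 + (k + 2) * (k + 2)) := by nlinarith
    nlinarith
  · intro k
    refine ⟨by simp only [length_familyString, familyLength]; omega, ?_⟩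
    intro P1 P2 P' Z _ h2 h' hZ
    have hz : (Z.length : ℝ) ≤ 7 * 2 ^ (k + 2) := by
      exact_mod_cast hZ.length_le_of_familyString
    have hp : ((k : ℝ) + 1) * 2 ^ (k + 1) ≤ P'.length := by
      exact_mod_cast length_ge_of_familyString h2 h'.1
    have hlog := logb_familyLength_le (b := k + 2) (by omega)
    rw [length_familyString]
    push_cast at hlog
    calc 1 / 84 * (Z.length : ℝ) * Real.logb 2 (familyLength (k + 2))
        ≤ 1 / 84 * (Z.length : ℝ) * (3 * (k + 2)) := by gcongr
      _ ≤ 1 / 84 * (7 * 2 ^ (k + 2)) * (3 * (k + 2)) := by gcongr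
      _ = (k + 2) / 2 * 2 ^ (k + 1) := by ring
      _ ≤ (k + 1) * 2 ^ (k + 1) := by
        gcongr
        have : (0 : ℝ) ≤ k := k.cast_nonneg
        linarith
      _ ≤ P'.length := hp
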